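/- The assignment x ↦ x, y ↦ y, t ↦ t, τ ↦ s² determines a well-defined group homomorphism φ : H → G, and φ is injective. -/

import Mathlib

/-! Generators and presentations for the groups `H` and `G` of Neumann–Shapiro. -/

inductive GenH : Type
  | x | y | t | tau
  deriving DecidableEq

inductive GenG : Type
  | x | y | s | t
  deriving DecidableEq

namespace NS

open FreeGroup

/-- Conjugation `a^b = b⁻¹ a b` in a group. -/
def cnj {Γ : Type*} [Group Γ] (a b : Γ) : Γ := b⁻¹ * a * b

/-! ### The group `H` -/

abbrev FH := FreeGroup GenH

def fx : FH := FreeGroup.of GenH.x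
def fy : FH := FreeGroup.of GenH.y
def ft : FH := FreeGroup.of GenH.t
def ftau : FH := FreeGroup.of GenH.tau

/-- The eight elements `x, x^t, x^τ, x^{tτ}, y, y^t, y^τ, y^{tτ}` (as words). -/
def basisH : List FH :=
  [fx, cnj fx ft, cnj fx ftau, cnj fx (ft * ftau),
   fy, cnj fy ft, cnj fy ftau, cnj fy (ft * ftau)]

/-- Relators of `H`: `t² = τ² = [τ,t] = 1`, the eight elements of `basisH` pairwise
commute, and `x · x^τ = y · y^t`. -/
def relsH : Set FH :=
  {ft ^ 2, ftau ^ 2, ftau⁻¹ * ft⁻¹ * ftau * ft} ∪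
    {r | ∃ a ∈ basisH, ∃ b ∈ basisH, r = a * b * a⁻¹ * b⁻¹} ∪
    {fx * cnj fx ftau * (fy * cnj fy ft)⁻¹}

abbrev H := PresentedGroup relsH

def Hx : H := PresentedGroup.of GenH.x
def Hy : H := PresentedGroup.of GenH.y
def Ht : H := PresentedGroup.of GenH.t
def Htau : H := PresentedGroup.of GenH.tau

/-! ### The group `G` -/

abbrev FG := FreeGroup GenG

def gx : FG := FreeGroup.of GenG.x
def gy : FG := FreeGroup.of GenG.y
def gs : FG := FreeGroup.of GenG.s
def gt : FG := FreeGroup.of GenG.t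

/-- The eight conjugating elements `1, s, s², s³, t, ts, ts², ts³`. -/
def conjsG : List FG := [1, gs, gs ^ 2, gs ^ 3, gt, gt * gs, gt * gs ^ 2, gt * gs ^ 3]

/-- The sixteen elements `x^α, y^α` for `α ∈ {1, s, s², s³, t, ts, ts², ts³}`. -/
def basisG : List FG :=
  conjsG.map (fun b => cnj gx b) ++ conjsG.map (fun b => cnj gy b)

/-- Relators of `G`: `t² = s⁴ = [s,t] = 1`, the sixteen elements of `basisG` pairwise
commute, and `x · x^{s²} = y · y^t`. -/
def relsG : Set FG :=
  {gt ^ 2, gs ^ 4, gs⁻¹ * gt⁻¹ * gs * gt} ∪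
    {r | ∃ a ∈ basisG, ∃ b ∈ basisG, r = a * b * a⁻¹ * b⁻¹} ∪
    {gx * cnj gx (gs ^ 2) * (gy * cnj gy gt)⁻¹}

abbrev G := PresentedGroup relsG

def Gx : G := PresentedGroup.of GenG.x
def Gy : G := PresentedGroup.of GenG.y
def Gs : G := PresentedGroup.of GenG.s
def Gt : G := PresentedGroup.of GenG.t

/-! ### Words, evaluation, lengths, geodesics -/

/-- A word over the symmetric alphabet on `α`: a letter `(a, true)` stands for the
generator `a` and `(a, false)` for its inverse. -/
abbrev Word (α : Type) := List (α × Bool)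

/-- Evaluate a word in a group, given the images of the generators. -/
def evalWith {α : Type} {Γ : Type*} [Group Γ] (f : α → Γ) (w : Word α) : Γ :=
  (w.map fun p => if p.2 then f p.1 else (f p.1)⁻¹).prod

/-- Evaluation of a word over `X_H = {x^{±1}, y^{±1}, t^{±1}, τ^{±1}}` in `H`. -/
def evalH : Word GenH → H := evalWith (fun a => (PresentedGroup.of a : H))

/-- Evaluation of a word over `X = {x^{±1}, y^{±1}, t^{±1}, s^{±1}}` in `G`. -/
def evalG : Word GenG → G := evalWith (fun a => (PresentedGroup.of a : G))

/-- Weight of a letter for `H`: the letters `x^{±1}, y^{±1}, t^{±1}` have length `1`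
and `τ^{±1}` has length `2`. -/
def wtH : GenH × Bool → ℕ
  | (GenH.tau, _) => 2
  | _ => 1

/-- Weighted length of a word over `X_H`. -/
def wlenH (w : Word GenH) : ℕ := (w.map wtH).sum

/-- `ℓ(h)`: the minimum weighted length of a word over `X_H` evaluating to `h`. -/
noncomputable def ellH (h : H) : ℕ := sInf {n | ∃ w : Word GenH, evalH w = h ∧ wlenH w = n}

/-- A word over `X_H` is geodesic if its weighted length is `ℓ` of its evaluation. -/
def IsGeodesicH (w : Word GenH) : Prop := wlenH w = ellH (evalH w)

/-- `ℓ_G(g)`: the minimum length (number of letters) of a word over `X` evaluating to `g`. -/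
noncomputable def ellG (g : G) : ℕ := sInf {n | ∃ w : Word GenG, evalG w = g ∧ w.length = n}

/-- A word over `X` is geodesic if its length is `ℓ_G` of its evaluation. -/
def IsGeodesicG (w : Word GenG) : Prop := w.length = ellG (evalG w)

end NS

namespace NS

variable {Γ Δ : Type*} [Group Γ] [Group Δ]

theorem map_cnj (f : Γ →* Δ) (a b : Γ) : f (cnj a b) = cnj (f a) (f b) := by
  simp [cnj]

theorem cnj_one_right (a : Γ) : cnj a 1 = a := by simp [cnj]

theorem cnj_one_left (b : Γ) : cnj 1 b = 1 := by simp [cnj]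

theorem cnj_mul (a b c : Γ) : cnj a (b * c) = cnj (cnj a b) c := by
  simp [cnj, mul_assoc]

theorem cnj_cnj_of_sq_eq_one (a : Γ) {b : Γ} (hb : b ^ 2 = 1) : cnj (cnj a b) b = a := by
  rw [← cnj_mul, ← sq, hb, cnj_one_right]

theorem commute_of_mul_mul_inv_mul_inv_eq_one {a b : Γ} (h : a * b * a⁻¹ * b⁻¹ = 1) :
    Commute a b :=
  commutatorElement_eq_one_iff_mul_comm.mp h

theorem inv_mul_inv_mul_mul_eq_one {a b : Γ} (h : Commute a b) : a⁻¹ * b⁻¹ * a * b = 1 := by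
  rw [mul_assoc, h.eq, ← mul_inv_rev, inv_mul_cancel]

theorem mul_mul_inv_mul_inv_eq_one {a b : Γ} (h : Commute a b) : a * b * a⁻¹ * b⁻¹ = 1 :=
  commutatorElement_eq_one_iff_mul_comm.mpr h

/-! ### The relations in `H` and `G` -/

theorem mkH_fx : PresentedGroup.mk relsH fx = Hx := rfl
theorem mkH_fy : PresentedGroup.mk relsH fy = Hy := rfl
theorem mkH_ft : PresentedGroup.mk relsH ft = Ht := rfl
theorem mkH_ftau : PresentedGroup.mk relsH ftau = Htau := rfl
theorem mkG_gx : PresentedGroup.mk relsG gx = Gx := rfl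
theorem mkG_gy : PresentedGroup.mk relsG gy = Gy := rfl
theorem mkG_gs : PresentedGroup.mk relsG gs = Gs := rfl
theorem mkG_gt : PresentedGroup.mk relsG gt = Gt := rfl

theorem Ht_sq : Ht ^ 2 = 1 := by
  have h : PresentedGroup.mk relsH (ft ^ 2) = 1 :=
    PresentedGroup.one_of_mem (by simp [relsH])
  simpa [mkH_ft] using h

theorem Htau_sq : Htau ^ 2 = 1 := by
  have h : PresentedGroup.mk relsH (ftau ^ 2) = 1 :=
    PresentedGroup.one_of_mem (by simp [relsH])
  simpa [mkH_ftau] using h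

theorem commute_Htau_Ht : Commute Htau Ht := by
  have h : PresentedGroup.mk relsH (ftau⁻¹ * ft⁻¹ * ftau * ft) = 1 :=
    PresentedGroup.one_of_mem (by simp [relsH])
  simp only [map_mul, map_inv, mkH_ft, mkH_ftau] at h
  exact Commute.inv_inv_iff.mp
    (commute_of_mul_mul_inv_mul_inv_eq_one (by simpa only [inv_inv] using h))

theorem Hx_mul_cnj : Hx * cnj Hx Htau = Hy * cnj Hy Ht := by
  have h : PresentedGroup.mk relsH (fx * cnj fx ftau * (fy * cnj fy ft)⁻¹) = 1 :=
    PresentedGroup.one_of_mem (by simp [relsH])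
  simp only [map_mul, map_inv, map_cnj, mkH_fx, mkH_fy, mkH_ft, mkH_ftau] at h
  exact mul_inv_eq_one.mp h

theorem commute_basisH {a b : FH} (ha : a ∈ basisH) (hb : b ∈ basisH) :
    Commute (PresentedGroup.mk relsH a) (PresentedGroup.mk relsH b) := by
  have h : PresentedGroup.mk relsH (a * b * a⁻¹ * b⁻¹) = 1 :=
    PresentedGroup.one_of_mem (Or.inl (Or.inr ⟨a, ha, b, hb, rfl⟩))
  exact commute_of_mul_mul_inv_mul_inv_eq_one (by simpa using h)

theorem Gt_sq : Gt ^ 2 = 1 := by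
  have h : PresentedGroup.mk relsG (gt ^ 2) = 1 :=
    PresentedGroup.one_of_mem (by simp [relsG])
  simpa [mkG_gt] using h

theorem Gs_pow_four : Gs ^ 4 = 1 := by
  have h : PresentedGroup.mk relsG (gs ^ 4) = 1 :=
    PresentedGroup.one_of_mem (by simp [relsG])
  simpa [mkG_gs] using h

theorem commute_Gs_Gt : Commute Gs Gt := by
  have h : PresentedGroup.mk relsG (gs⁻¹ * gt⁻¹ * gs * gt) = 1 :=
    PresentedGroup.one_of_mem (by simp [relsG])
  simp only [map_mul, map_inv, mkG_gt, mkG_gs] at h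
  exact Commute.inv_inv_iff.mp
    (commute_of_mul_mul_inv_mul_inv_eq_one (by simpa only [inv_inv] using h))

theorem Gx_mul_cnj : Gx * cnj Gx (Gs ^ 2) = Gy * cnj Gy Gt := by
  have h : PresentedGroup.mk relsG (gx * cnj gx (gs ^ 2) * (gy * cnj gy gt)⁻¹) = 1 :=
    PresentedGroup.one_of_mem (by simp [relsG])
  simp only [map_mul, map_inv, map_pow, map_cnj, mkG_gx, mkG_gy, mkG_gt, mkG_gs] at h
  exact mul_inv_eq_one.mp h

theorem commute_basisG {a b : FG} (ha : a ∈ basisG) (hb : b ∈ basisG) :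
    Commute (PresentedGroup.mk relsG a) (PresentedGroup.mk relsG b) := by
  have h : PresentedGroup.mk relsG (a * b * a⁻¹ * b⁻¹) = 1 :=
    PresentedGroup.one_of_mem (Or.inl (Or.inr ⟨a, ha, b, hb, rfl⟩))
  exact commute_of_mul_mul_inv_mul_inv_eq_one (by simpa using h)

/-! ### The homomorphism `H →* G` -/

/-- The images in `G` of the generators of `H`. -/
def genHToG : GenH → G
  | .x => Gx
  | .y => Gy
  | .t => Gt
  | .tau => Gs ^ 2

theorem lift_genHToG_basisH {a : FH} (ha : a ∈ basisH) :
    ∃ b ∈ basisG, FreeGroup.lift genHToG a = PresentedGroup.mk relsG b := by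
  have hx : FreeGroup.lift genHToG fx = Gx := FreeGroup.lift_apply_of
  have hy : FreeGroup.lift genHToG fy = Gy := FreeGroup.lift_apply_of
  have ht : FreeGroup.lift genHToG ft = Gt := FreeGroup.lift_apply_of
  have htau : FreeGroup.lift genHToG ftau = Gs ^ 2 := FreeGroup.lift_apply_of
  simp only [basisH, List.mem_cons, List.not_mem_nil, or_false] at ha
  rcases ha with rfl | rfl | rfl | rfl | rfl | rfl | rfl | rfl
  · exact ⟨cnj gx 1, by simp [basisG, conjsG], by simp [hx, cnj_one_right, mkG_gx]⟩
  · exact ⟨cnj gx gt, by simp [basisG, conjsG], by simp [hx, ht, map_cnj, mkG_gx, mkG_gt]⟩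
  · exact ⟨cnj gx (gs ^ 2), by simp [basisG, conjsG],
      by simp [hx, htau, map_cnj, mkG_gx, mkG_gs]⟩
  · exact ⟨cnj gx (gt * gs ^ 2), by simp [basisG, conjsG],
      by simp [hx, ht, htau, map_cnj, mkG_gx, mkG_gs, mkG_gt]⟩
  · exact ⟨cnj gy 1, by simp [basisG, conjsG], by simp [hy, cnj_one_right, mkG_gy]⟩
  · exact ⟨cnj gy gt, by simp [basisG, conjsG], by simp [hy, ht, map_cnj, mkG_gy, mkG_gt]⟩
  · exact ⟨cnj gy (gs ^ 2), by simp [basisG, conjsG],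
      by simp [hy, htau, map_cnj, mkG_gy, mkG_gs]⟩
  · exact ⟨cnj gy (gt * gs ^ 2), by simp [basisG, conjsG],
      by simp [hy, ht, htau, map_cnj, mkG_gy, mkG_gs, mkG_gt]⟩

theorem lift_genHToG_relsH : ∀ r ∈ relsH, FreeGroup.lift genHToG r = 1 := by
  have hx : FreeGroup.lift genHToG fx = Gx := FreeGroup.lift_apply_of
  have hy : FreeGroup.lift genHToG fy = Gy := FreeGroup.lift_apply_of
  have ht : FreeGroup.lift genHToG ft = Gt := FreeGroup.lift_apply_of
  have htau : FreeGroup.lift genHToG ftau = Gs ^ 2 := FreeGroup.lift_apply_of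
  rintro r (((rfl | rfl | rfl) | ⟨a, ha, b, hb, rfl⟩) | rfl)
  · rw [map_pow, ht, Gt_sq]
  · rw [map_pow, htau, ← pow_mul, Gs_pow_four]
  · simp only [map_mul, map_inv, ht, htau]
    exact inv_mul_inv_mul_mul_eq_one (commute_Gs_Gt.pow_left 2)
  · obtain ⟨a', ha', ea⟩ := lift_genHToG_basisH ha
    obtain ⟨b', hb', eb⟩ := lift_genHToG_basisH hb
    simp only [map_mul, map_inv, ea, eb]
    exact mul_mul_inv_mul_inv_eq_one (commute_basisG ha' hb')
  · simp only [map_mul, map_inv, map_cnj, hx, hy, ht, htau]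
    exact mul_inv_eq_one.mpr Gx_mul_cnj

/-- The homomorphism `H →* G` given by `x ↦ x`, `y ↦ y`, `t ↦ t`, `τ ↦ s²`. -/
def HToG : H →* G := PresentedGroup.toGroup lift_genHToG_relsH

/-! ### An action of `G` on two copies of `H` -/

/-- `Γ × Γ` acting on two copies of `Γ` by left multiplication in each copy. -/
def diagPerm (a b : Γ) : Equiv.Perm (Γ ⊕ Γ) :=
  Equiv.sumCongr (Equiv.mulLeft a) (Equiv.mulLeft b)

/-- The permutation of two copies of `Γ` sending the first copy identically to the second and
the second to the first by left multiplication by `c`. Its square is `diagPerm c c`. -/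
def swapPerm (c : Γ) : Equiv.Perm (Γ ⊕ Γ) :=
  diagPerm c 1 * Equiv.sumComm Γ Γ

theorem diagPerm_one : diagPerm (1 : Γ) 1 = 1 := by
  ext (h | h) <;> simp [diagPerm]

theorem diagPerm_mul (a b c d : Γ) :
    diagPerm a b * diagPerm c d = diagPerm (a * c) (b * d) := by
  ext (h | h) <;> simp [diagPerm, mul_assoc]

theorem diagPerm_inv (a b : Γ) : (diagPerm a b)⁻¹ = diagPerm a⁻¹ b⁻¹ :=
  inv_eq_of_mul_eq_one_right (by simp [diagPerm_mul, diagPerm_one])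

theorem cnj_diagPerm (a b c d : Γ) :
    cnj (diagPerm a b) (diagPerm c d) = diagPerm (cnj a c) (cnj b d) := by
  simp only [cnj, diagPerm_inv, diagPerm_mul]

theorem diagPerm_mul_swapPerm (a b c : Γ) :
    diagPerm a b * swapPerm c = swapPerm c * diagPerm b (cnj a c) := by
  ext (h | h) <;> simp [swapPerm, diagPerm, cnj, mul_assoc]

theorem cnj_swapPerm (a b c : Γ) :
    cnj (diagPerm a b) (swapPerm c) = diagPerm b (cnj a c) := by
  rw [cnj, mul_assoc, diagPerm_mul_swapPerm, inv_mul_cancel_left]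

theorem swapPerm_sq (c : Γ) : swapPerm c ^ 2 = diagPerm c c := by
  ext (h | h) <;> simp [sq, swapPerm, diagPerm]

theorem commute_diagPerm {a b c d : Γ} (hac : Commute a c) (hbd : Commute b d) :
    Commute (diagPerm a b) (diagPerm c d) := by
  rw [Commute, SemiconjBy, diagPerm_mul, diagPerm_mul, hac.eq, hbd.eq]

/-- The permutations of two copies of `H` by which the generators of `G` act. -/
def genGToPerm : GenG → Equiv.Perm (H ⊕ H)
  | .x => diagPerm Hx 1
  | .y => diagPerm Hy 1
  | .s => swapPerm Htau
  | .t => diagPerm Ht Ht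

theorem lift_gx : FreeGroup.lift genGToPerm gx = diagPerm Hx 1 := FreeGroup.lift_apply_of
theorem lift_gy : FreeGroup.lift genGToPerm gy = diagPerm Hy 1 := FreeGroup.lift_apply_of
theorem lift_gs : FreeGroup.lift genGToPerm gs = swapPerm Htau := FreeGroup.lift_apply_of
theorem lift_gt : FreeGroup.lift genGToPerm gt = diagPerm Ht Ht := FreeGroup.lift_apply_of

/-- The images in `H` of the eight basis elements, together with `1`. -/
def oneBasisH : Set H := insert 1 {h | ∃ a ∈ basisH, PresentedGroup.mk relsH a = h}

theorem commute_oneBasisH {g h : H} (hg : g ∈ oneBasisH) (hh : h ∈ oneBasisH) :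
    Commute g h := by
  rcases hg with rfl | ⟨a, ha, rfl⟩
  · exact Commute.one_left h
  rcases hh with rfl | ⟨b, hb, rfl⟩
  · exact Commute.one_right _
  exact commute_basisH ha hb

theorem one_mem_oneBasisH : 1 ∈ oneBasisH := Or.inl rfl

theorem cnj_mem_oneBasisH {z : FH} (hz : z = fx ∨ z = fy) :
    PresentedGroup.mk relsH z ∈ oneBasisH ∧
    cnj (PresentedGroup.mk relsH z) Ht ∈ oneBasisH ∧
    cnj (PresentedGroup.mk relsH z) Htau ∈ oneBasisH ∧
    cnj (cnj (PresentedGroup.mk relsH z) Ht) Htau ∈ oneBasisH := by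
  rcases hz with rfl | rfl
  · refine ⟨Or.inr ⟨fx, ?_, rfl⟩, Or.inr ⟨cnj fx ft, ?_, map_cnj _ _ _⟩,
      Or.inr ⟨cnj fx ftau, ?_, map_cnj _ _ _⟩, Or.inr ⟨cnj fx (ft * ftau), ?_, ?_⟩⟩
    iterate 4 simp [basisH]
    rw [cnj_mul, map_cnj, map_cnj, mkH_ft, mkH_ftau]
  · refine ⟨Or.inr ⟨fy, ?_, rfl⟩, Or.inr ⟨cnj fy ft, ?_, map_cnj _ _ _⟩,
      Or.inr ⟨cnj fy ftau, ?_, map_cnj _ _ _⟩, Or.inr ⟨cnj fy (ft * ftau), ?_, ?_⟩⟩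
    iterate 4 simp [basisH]
    rw [cnj_mul, map_cnj, map_cnj, mkH_ft, mkH_ftau]

theorem cnj_diagPerm_conjsG {z : FH} (hz : z = fx ∨ z = fy) {c : FG} (hc : c ∈ conjsG) :
    ∃ g ∈ oneBasisH, ∃ h ∈ oneBasisH,
      cnj (diagPerm (PresentedGroup.mk relsH z) 1) (FreeGroup.lift genGToPerm c) =
        diagPerm g h := by
  obtain ⟨h₀, h₁, h₂, h₃⟩ := cnj_mem_oneBasisH hz
  have one := one_mem_oneBasisH
  simp only [conjsG, List.mem_cons, List.not_mem_nil, or_false] at hc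
  rcases hc with rfl | rfl | rfl | rfl | rfl | rfl | rfl | rfl <;>
    simp only [map_one, map_mul, lift_gs, lift_gt, pow_succ, pow_zero, one_mul, cnj_mul,
      cnj_one_right, cnj_one_left, cnj_diagPerm, cnj_swapPerm, cnj_cnj_of_sq_eq_one _ Htau_sq]
  exacts [⟨_, h₀, _, one, rfl⟩, ⟨_, one, _, h₂, rfl⟩, ⟨_, h₂, _, one, rfl⟩,
    ⟨_, one, _, h₀, rfl⟩, ⟨_, h₁, _, one, rfl⟩, ⟨_, one, _, h₃, rfl⟩,
    ⟨_, h₃, _, one, rfl⟩, ⟨_, one, _, h₁, rfl⟩]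

theorem lift_genGToPerm_basisG {a : FG} (ha : a ∈ basisG) :
    ∃ g ∈ oneBasisH, ∃ h ∈ oneBasisH, FreeGroup.lift genGToPerm a = diagPerm g h := by
  simp only [basisG, List.mem_append, List.mem_map] at ha
  rcases ha with ⟨c, hc, rfl⟩ | ⟨c, hc, rfl⟩
  · rw [map_cnj, lift_gx]
    exact cnj_diagPerm_conjsG (Or.inl rfl) hc
  · rw [map_cnj, lift_gy]
    exact cnj_diagPerm_conjsG (Or.inr rfl) hc

theorem lift_genGToPerm_relsG : ∀ r ∈ relsG, FreeGroup.lift genGToPerm r = 1 := by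
  rintro r (((rfl | rfl | rfl) | ⟨a, ha, b, hb, rfl⟩) | rfl)
  · rw [map_pow, lift_gt, sq, diagPerm_mul, ← sq, Ht_sq, diagPerm_one]
  · rw [map_pow, lift_gs, show 4 = 2 * 2 from rfl, pow_mul, swapPerm_sq, sq, diagPerm_mul,
      ← sq, Htau_sq, diagPerm_one]
  · simp only [map_mul, map_inv, lift_gs, lift_gt]
    refine inv_mul_inv_mul_mul_eq_one (Commute.symm ?_)
    have h : cnj Ht Htau = Ht := by
      rw [cnj, mul_assoc, ← commute_Htau_Ht.eq, inv_mul_cancel_left]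
    rw [Commute, SemiconjBy, diagPerm_mul_swapPerm, h]
  · obtain ⟨g, hg, h, hh, ea⟩ := lift_genGToPerm_basisG ha
    obtain ⟨g', hg', h', hh', eb⟩ := lift_genGToPerm_basisG hb
    simp only [map_mul, map_inv, ea, eb]
    exact mul_mul_inv_mul_inv_eq_one
      (commute_diagPerm (commute_oneBasisH hg hg') (commute_oneBasisH hh hh'))
  · simp only [map_mul, map_inv, map_pow, map_cnj, lift_gx, lift_gy, lift_gs, lift_gt,
      swapPerm_sq, cnj_diagPerm, diagPerm_mul, cnj_one_left, Hx_mul_cnj]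
    exact mul_inv_cancel _

/-- The action of `G` on two copies of `H`, induced from the left regular action of `H`. -/
def GToPerm : G →* Equiv.Perm (H ⊕ H) := PresentedGroup.toGroup lift_genGToPerm_relsG

theorem GToPerm_HToG_inl (h g : H) : GToPerm (HToG h) (Sum.inl g) = Sum.inl (h * g) := by
  induction h using PresentedGroup.induction_on with | _ w
  induction w using FreeGroup.induction_on generalizing g with
  | C1 => simp
  | of a =>
    change GToPerm (HToG (PresentedGroup.of a)) (Sum.inl g) = Sum.inl (PresentedGroup.of a * g)
    rw [HToG, PresentedGroup.toGroup.of]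
    cases a with
    | tau =>
      rw [genHToG, map_pow, Gs, GToPerm, PresentedGroup.toGroup.of, genGToPerm, swapPerm_sq]
      rfl
    | x | y | t =>
      exact congrArg (fun p : Equiv.Perm (H ⊕ H) => p (Sum.inl g))
        (PresentedGroup.toGroup.of lift_genGToPerm_relsG)
  | inv_of a ih =>
    rw [map_inv, map_inv, map_inv, Equiv.Perm.inv_eq_iff_eq, ih, mul_inv_cancel_left]
  | mul a b iha ihb =>
    rw [map_mul, map_mul, map_mul, Equiv.Perm.mul_apply, ihb, iha, mul_assoc]

theorem HToG_injective : Function.Injective HToG := fun a b hab => by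
  have h := GToPerm_HToG_inl a 1
  rw [hab, GToPerm_HToG_inl, mul_one, mul_one] at h
  exact (Sum.inl_injective h).symm

end NS

open NS in
/-- The assignment `x ↦ x`, `y ↦ y`, `t ↦ t`, `τ ↦ s²` determines a well-defined group
homomorphism `φ : H → G`, and `φ` is injective. -/
theorem H_embeds_in_G :
    ∃ φ : H →* G,
      (φ Hx = Gx ∧ φ Hy = Gy ∧ φ Ht = Gt ∧ φ Htau = Gs ^ 2) ∧
      Function.Injective φ := by
  exact ⟨HToG, ⟨PresentedGroup.toGroup.of _, PresentedGroup.toGroup.of _,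
    PresentedGroup.toGroup.of _, PresentedGroup.toGroup.of _⟩, HToG_injective⟩
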